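/- arXiv:1609.03447 — 6 statements merged into one kernel-verified Lean document; each statement's English description precedes it below -/
import Mathlib

section
/- Let d=1 and α≥1. Suppose (x,v) is a C¹ solution of the Cucker–Smale system with singular communication weight ψ(s)=s^{-α} on the interval [0,t₀) such that the initial positions are pairwise distinct (x_i(0)≠x_j(0) for all i≠j) and the positions remain pairwise distinct on [0,t₀). Then t₀ cannot be a first collision time: the continuous extensions of the trajectories to t=t₀ still satisfy x_i(t₀)≠x_j(t₀) for all i≠j. Consequently, for pairwise distinct initial positions the system admits a unique smooth global solution whose trajectories never collide in finite time. -/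
section CSAux
open Set Filter Topology

/-- forward uniqueness -/
lemma csode_unique {E : Type*} [NormedAddCommGroup E] [NormedSpace ℝ E]
    {f : E → E} {U : Set E} (hf : ∀ y ∈ U, ContDiffAt ℝ 1 f y) {T : ℝ} {γ γ' : ℝ → E}
    (h : ∀ t ∈ Ico (0:ℝ) T, HasDerivAt γ (f (γ t)) t ∧ γ t ∈ U)
    (h' : ∀ t ∈ Ico (0:ℝ) T, HasDerivAt γ' (f (γ' t)) t ∧ γ' t ∈ U)
    (h0 : γ 0 = γ' 0) : ∀ t ∈ Ico (0:ℝ) T, γ t = γ' t := by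
  intro b hb
  have hsub : Icc 0 b ⊆ Ico 0 T := fun s hs => ⟨hs.1, hs.2.trans_lt hb.2⟩
  have hc : ContinuousOn γ (Icc 0 b) :=
    fun s hs => (h s (hsub hs)).1.continuousAt.continuousWithinAt
  have hc' : ContinuousOn γ' (Icc 0 b) :=
    fun s hs => (h' s (hsub hs)).1.continuousAt.continuousWithinAt
  have hcl : IsClosed ({t | γ t = γ' t} ∩ Icc 0 b) := by
    have := (hc.prodMk hc').preimage_isClosed_of_isClosed isClosed_Icc isClosed_diagonal
    convert this using 1
    ext t; simp [and_comm]
  have key := hcl.Icc_subset_of_forall_mem_nhdsWithin (a := 0) (b := b) h0 ?_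
  · exact key ⟨hb.1, le_rfl⟩
  · rintro t ⟨hte, ht⟩
    have hte : γ t = γ' t := hte
    have htT : t ∈ Ico 0 T := ⟨ht.1, ht.2.trans hb.2⟩
    obtain ⟨K, s, hs, hl⟩ := (hf _ (h t htT).2).exists_lipschitzOnWith
    have e1 : ∀ᶠ r in 𝓝 t, γ r ∈ s := (h t htT).1.continuousAt hs
    have e2 : ∀ᶠ r in 𝓝 t, γ' r ∈ s := (h' t htT).1.continuousAt (hte ▸ hs)
    have e3 : ∀ᶠ r in 𝓝 t, r < T := Iio_mem_nhds htT.2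
    obtain ⟨ε, hε, he⟩ := Metric.eventually_nhds_iff_ball.1 (e1.and (e2.and e3))
    have hmem : ∀ r ∈ Icc t (t + ε/2), r ∈ Metric.ball t ε := by
      intro r hr
      rw [Real.ball_eq_Ioo]; constructor <;> linarith [hr.1, hr.2]
    have hI : ∀ r ∈ Icc t (t + ε/2), r ∈ Ico 0 T :=
      fun r hr => ⟨ht.1.trans hr.1, (he r (hmem r hr)).2.2⟩
    have hu := ODE_solution_unique_of_mem_Icc_right (v := fun _ => f) (s := fun _ => s) (K := K)
      (f := γ) (g := γ') (a := t) (b := t + ε/2) (fun _ _ => hl)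
      (fun r hr => (h r (hI r hr)).1.continuousAt.continuousWithinAt)
      (fun r hr => (h r (hI r (Ico_subset_Icc_self hr))).1.hasDerivWithinAt)
      (fun r hr => (he r (hmem r (Ico_subset_Icc_self hr))).1)
      (fun r hr => (h' r (hI r hr)).1.continuousAt.continuousWithinAt)
      (fun r hr => (h' r (hI r (Ico_subset_Icc_self hr))).1.hasDerivWithinAt)
      (fun r hr => (he r (hmem r (Ico_subset_Icc_self hr))).2.1) hte
    refine mem_of_superset (Ioo_mem_nhdsGT (show t < t + ε/2 by linarith)) ?_
    intro r hr
    exact hu (Ioo_subset_Icc_self hr)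

/-- extension past `T`. -/
lemma csode_extend {E : Type*} [NormedAddCommGroup E] [NormedSpace ℝ E] [CompleteSpace E]
    {f : E → E} {U : Set E} (hU : IsOpen U) (hf : ∀ y ∈ U, ContDiffAt ℝ 1 f y) {T : ℝ}
    (hT : 0 < T) {γ : ℝ → E}
    (h : ∀ t ∈ Ico (0:ℝ) T, HasDerivAt γ (f (γ t)) t ∧ γ t ∈ U) {y : E} (hy : y ∈ U)
    (hlim : Tendsto γ (𝓝[<] T) (𝓝 y)) :
    ∃ T' > T, ∃ β : ℝ → E, β 0 = γ 0 ∧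
      ∀ t ∈ Ico (0:ℝ) T', HasDerivAt β (f (β t)) t ∧ β t ∈ U := by
  obtain ⟨β, hβ0, ε, hε, hβ⟩ :=
    (hf y hy).exists_forall_mem_closedBall_exists_eq_forall_mem_Ioo_hasDerivAt₀ T
  have hβT := hβ T ⟨by linarith, by linarith⟩
  have e1 : ∀ᶠ r in 𝓝 T, β r ∈ U := hβT.continuousAt (hU.mem_nhds (hβ0 ▸ hy))
  have e2 : ∀ᶠ r in 𝓝 T, r ∈ Ioo (T - ε) (T + ε) := Ioo_mem_nhds (by linarith) (by linarith)
  obtain ⟨δ, hδ, he⟩ := Metric.eventually_nhds_iff_ball.1 (e1.and e2)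
  classical
  set g : ℝ → E := fun t => if t < T then γ t else β t with hg
  have hlt : ∀ t < T, g =ᶠ[𝓝 t] γ := by
    intro t ht
    filter_upwards [Iio_mem_nhds ht] with r hr
    simp only [hg]; rw [if_pos (show r < T from hr)]
  have hgt : ∀ t, T < t → g =ᶠ[𝓝 t] β := by
    intro t ht
    filter_upwards [Ioi_mem_nhds ht] with r hr
    simp only [hg]; rw [if_neg (not_lt.2 (le_of_lt hr))]
  have hgT : g T = y := by simp [hg, hβ0]
  refine ⟨T + δ, by linarith, g, by simp [hg, hT], ?_⟩
  intro t ht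
  rcases lt_trichotomy t T with hlt' | rfl | hgt'
  · have := h t ⟨ht.1, hlt'⟩
    have e := hlt t hlt'
    rw [e.eq_of_nhds]
    exact ⟨this.1.congr_of_eventuallyEq e, this.2⟩
  · rw [hgT]
    refine ⟨?_, hy⟩
    have hr : HasDerivWithinAt g (f y) (Ici t) t := by
      have : HasDerivWithinAt β (f y) (Ici t) t := by
        rw [hβ0] at hβT; exact hβT.hasDerivWithinAt
      refine this.congr (fun r hr => ?_) (by rw [hgT, hβ0])
      simp only [hg]; rw [if_neg (not_lt.2 hr)]
    have hl : HasDerivWithinAt g (f y) (Iic t) t := by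
      have hd : ∀ r ∈ Ioo 0 t, HasDerivAt g (f (γ r)) r := fun r hr =>
        (h r ⟨hr.1.le, hr.2⟩).1.congr_of_eventuallyEq (hlt r hr.2)
      have hs : Ioo 0 t ∈ 𝓝[<] t := Ioo_mem_nhdsLT hT
      apply hasDerivWithinAt_Iic_of_tendsto_deriv (s := Ioo 0 t)
        (fun r hr => (hd r hr).differentiableAt.differentiableWithinAt) _ hs
      · have : Tendsto (fun r => f (γ r)) (𝓝[<] t) (𝓝 (f y)) :=
          ((hf y hy).continuousAt.tendsto).comp hlim
        refine this.congr' ?_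
        filter_upwards [hs] with r hr
        exact (hd r hr).deriv.symm
      · unfold ContinuousWithinAt
        rw [hgT]
        have : Tendsto γ (𝓝[Ioo 0 t] t) (𝓝 y) :=
          hlim.mono_left (nhdsWithin_mono _ (fun r hr => hr.2))
        refine this.congr' ?_
        filter_upwards [self_mem_nhdsWithin] with r hr
        exact ((hlt r hr.2).eq_of_nhds).symm
    have := hl.union hr
    rwa [Iic_union_Ici, hasDerivWithinAt_univ] at this
  · have hb : t ∈ Metric.ball T δ := by
      rw [Real.ball_eq_Ioo]; constructor <;> linarith [ht.2]
    have e := hgt t hgt'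
    rw [e.eq_of_nhds]
    exact ⟨(hβ t (he t hb).2).congr_of_eventuallyEq e, (he t hb).1⟩

lemma csode_global {E : Type*} [NormedAddCommGroup E] [NormedSpace ℝ E] [CompleteSpace E]
    {f : E → E} {U : Set E} (hU : IsOpen U) (hf : ∀ y ∈ U, ContDiffAt ℝ 1 f y)
    {z : E} (hz : z ∈ U)
    (hext : ∀ T > 0, ∀ γ : ℝ → E, γ 0 = z →
      (∀ t ∈ Ico (0:ℝ) T, HasDerivAt γ (f (γ t)) t ∧ γ t ∈ U) →
      ∃ y ∈ U, Tendsto γ (𝓝[<] T) (𝓝 y)) :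
    ∃ Γ : ℝ → E, Γ 0 = z ∧ ∀ t, 0 ≤ t → HasDerivAt Γ (f (Γ t)) t ∧ Γ t ∈ U := by
  let P : ℝ → (ℝ → E) → Prop := fun T γ => γ 0 = z ∧
      (∀ t ∈ Ico (0:ℝ) T, HasDerivAt γ (f (γ t)) t ∧ γ t ∈ U)
  have huniq : ∀ T T' γ γ', P T γ → P T' γ' → ∀ t, 0 ≤ t → t < T → t < T' → γ t = γ' t := by
    intro T T' γ γ' h h' t h0 h1 h2
    exact csode_unique hf (T := min T T')
      (fun s hs => h.2 s ⟨hs.1, hs.2.trans_le (min_le_left _ _)⟩)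
      (fun s hs => h'.2 s ⟨hs.1, hs.2.trans_le (min_le_right _ _)⟩)
      (h.1.trans h'.1.symm) t ⟨h0, lt_min h1 h2⟩
  -- gluing
  have glue : ∀ B : Set ℝ, (0:ℝ) ∈ B → (∀ t ∈ B, 0 ≤ t) →
      (∀ t ∈ B, ∃ T > t, ∃ γ, P T γ) → (∀ t ∈ B, ∀ᶠ r in 𝓝 t, 0 ≤ r → r ∈ B) →
      ∃ Γ : ℝ → E, Γ 0 = z ∧ ∀ t ∈ B, HasDerivAt Γ (f (Γ t)) t ∧ Γ t ∈ U := by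
    intro B hB0 hBn hB hBo
    choose! τ hτ σ hσ using hB
    refine ⟨fun t => σ (max t 0) t, by simpa using (hσ 0 hB0).1, ?_⟩
    intro t ht
    have ht0 := hBn t ht
    have hmt : max t 0 = t := max_eq_left ht0
    have e : (fun t => σ (max t 0) t) =ᶠ[𝓝 t] σ t := by
      have e1 : ∀ᶠ r in 𝓝 t, r < τ t := Iio_mem_nhds (hτ t ht)
      have e2 : ∀ᶠ r in 𝓝 t, r < 0 → t = 0 := by
        rcases ht0.eq_or_lt with h | h
        · exact Eventually.of_forall fun _ _ => h.symm
        · filter_upwards [Ioi_mem_nhds h] with r hr hr'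
          exact absurd hr' (not_lt.2 (le_of_lt hr))
      filter_upwards [e1, e2, hBo t ht] with r h1 h2 h3
      rcases lt_or_ge r 0 with hr | hr
      · rw [max_eq_right hr.le, h2 hr]
      · rw [max_eq_left hr]
        exact huniq _ _ _ _ (hσ r (h3 hr)) (hσ t ht) r hr (hτ r (h3 hr)) h1
    have hs := (hσ t ht).2 t ⟨ht0, hτ t ht⟩
    have hv : (fun t => σ (max t 0) t) t = σ t t := e.eq_of_nhds
    rw [hv]
    exact ⟨hs.1.congr_of_eventuallyEq e, hs.2⟩
  have hall : ∀ t, 0 ≤ t → ∃ T > t, ∃ γ, P T γ := by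
    by_contra! hcon
    obtain ⟨t₁, ht₁, hno⟩ := hcon
    have hloc : ∃ ε > 0, ∃ γ, P ε γ := by
      obtain ⟨β, hβ0, ε, hε, hβ⟩ :=
        (hf z hz).exists_forall_mem_closedBall_exists_eq_forall_mem_Ioo_hasDerivAt₀ 0
      have hβT := hβ 0 ⟨by linarith, by linarith⟩
      have e1 : ∀ᶠ r in 𝓝 (0:ℝ), β r ∈ U := hβT.continuousAt (hU.mem_nhds (hβ0 ▸ hz))
      have e2 : ∀ᶠ r in 𝓝 (0:ℝ), r ∈ Ioo (0 - ε) (0 + ε) :=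
        Ioo_mem_nhds (by linarith) (by linarith)
      obtain ⟨δ, hδ, he⟩ := Metric.eventually_nhds_iff_ball.1 (e1.and e2)
      refine ⟨δ, hδ, β, hβ0, fun t ht => ?_⟩
      have hb : t ∈ Metric.ball 0 δ := by
        rw [Real.ball_eq_Ioo]; constructor <;> linarith [ht.1, ht.2]
      exact ⟨hβ t (he t hb).2, (he t hb).1⟩
    set S : Set ℝ := {T | ∃ γ, P T γ} with hS
    obtain ⟨ε, hε, hεS⟩ := hloc
    have hbdd : BddAbove S := ⟨t₁, fun T ⟨γ, hγ⟩ => by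
      by_contra! hc
      exact hno T hc γ hγ⟩
    have hle : ε ≤ sSup S := le_csSup hbdd hεS
    have hpos : 0 < sSup S := hε.trans_le hle
    obtain ⟨Γ, hΓ0, hΓ⟩ := glue (Ico 0 (sSup S)) ⟨le_rfl, hpos⟩ (fun t ht => ht.1)
      (fun t ht => by
        obtain ⟨T, hT, h⟩ := exists_lt_of_lt_csSup ⟨ε, hεS⟩ ht.2
        exact ⟨T, h, hT⟩)
      (fun t ht => by
        filter_upwards [Iio_mem_nhds ht.2] with r hr h0
        exact ⟨h0, hr⟩)
    obtain ⟨y, hy, hlim⟩ := hext _ hpos Γ hΓ0 hΓ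
    obtain ⟨T', hT', β, hβ0, hβ⟩ := csode_extend hU hf hpos hΓ hy hlim
    exact absurd (le_csSup hbdd (show T' ∈ S from ⟨β, hβ0.trans hΓ0, hβ⟩)) (not_le.2 hT')
  exact glue (Ici 0) (mem_Ici.2 le_rfl) (fun t ht => ht) hall (fun t _ => Eventually.of_forall fun r hr => hr)


lemma cs_primitive (α : ℝ) (hα : 1 ≤ α) : ∃ G : ℝ → ℝ,
    (∀ s > 0, HasDerivAt G (s ^ (-α)) s) ∧ Tendsto G (𝓝[>] 0) atBot := by
  rcases hα.eq_or_lt with rfl | h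
  · refine ⟨Real.log, fun s hs => ?_, Real.tendsto_log_nhdsGT_zero⟩
    rw [Real.rpow_neg_one]; exact Real.hasDerivAt_log hs.ne'
  · refine ⟨fun s => s ^ (1 - α) / (1 - α), fun s hs => ?_, ?_⟩
    · have := (Real.hasDerivAt_rpow_const (x := s) (p := 1 - α) (Or.inl hs.ne')).div_const (1 - α)
      refine this.congr_deriv ?_
      have : 1 - α ≠ 0 := by linarith
      rw [mul_div_cancel_left₀ _ this]
      congr 1; ring
    · have := tendsto_rpow_neg_nhdsGT_zero (y := 1 - α) (by linarith)
      exact this.atTop_div_const_of_neg (by linarith)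

section
variable {N : ℕ} {α t₀ : ℝ} {x v : ℝ → Fin N → ℝ}

lemma cs_order
    (hx : ∀ i, ∀ t ∈ Ico (0 : ℝ) t₀, HasDerivAt (fun s => x s i) (v t i) t)
    (hsep : ∀ t ∈ Ico (0 : ℝ) t₀, ∀ i j : Fin N, i ≠ j → x t i ≠ x t j)
    {p k : Fin N} (h0 : x 0 p < x 0 k) : ∀ t ∈ Ico (0 : ℝ) t₀, x t p < x t k := by
  intro t ht
  by_contra! hc
  have hne : p ≠ k := by rintro rfl; exact lt_irrefl _ h0
  have hsub : ∀ s ∈ Icc 0 t, s ∈ Ico 0 t₀ := fun s hs => ⟨hs.1, hs.2.trans_lt ht.2⟩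
  have hcont : ContinuousOn (fun s => x s k - x s p) (Icc 0 t) := fun s hs =>
    ((hx k s (hsub s hs)).continuousAt.sub
      (hx p s (hsub s hs)).continuousAt).continuousWithinAt
  obtain ⟨s, hs, hs0⟩ := intermediate_value_Icc' ht.1 hcont
    (show (0:ℝ) ∈ Icc _ _ from ⟨by linarith, by linarith⟩)
  exact hsep s (hsub s hs) p k hne (by simp only at hs0; linarith)

lemma cs_conserved (ht₀ : 0 < t₀)
    (hx : ∀ i, ∀ t ∈ Ico (0 : ℝ) t₀, HasDerivAt (fun s => x s i) (v t i) t)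
    (hv : ∀ i, ∀ t ∈ Ico (0 : ℝ) t₀, HasDerivAt (fun s => v s i)
      ((N : ℝ)⁻¹ * ∑ j, (|x t i - x t j| ^ (-α)) * (v t j - v t i)) t)
    (hsep : ∀ t ∈ Ico (0 : ℝ) t₀, ∀ i j : Fin N, i ≠ j → x t i ≠ x t j)
    {G : ℝ → ℝ} (hG : ∀ s > 0, HasDerivAt G (s ^ (-α)) s) (p : Fin N) :
    ∃ c : ℝ, ∀ t ∈ Ico (0 : ℝ) t₀,
      v t p = c - (N : ℝ)⁻¹ * ∑ k, Real.sign (x 0 p - x 0 k) * G |x t p - x t k| := by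
  have h1 : ∀ k, ∀ t ∈ Ico (0 : ℝ) t₀,
      HasDerivAt (fun s => Real.sign (x 0 p - x 0 k) * G |x s p - x s k|)
        (|x t p - x t k| ^ (-α) * (v t p - v t k)) t := by
    intro k t ht
    rcases lt_trichotomy (x 0 p) (x 0 k) with h | h | h
    · have ho := cs_order hx hsep h
      rw [Real.sign_of_neg (by linarith)]
      have hd := (hx k t ht).sub (hx p t ht)
      have hg := (hG (x t k - x t p) (by linarith [ho t ht]))
      have := (HasDerivAt.comp t hg hd).const_mul (-1)
      rw [abs_sub_comm, abs_of_pos (sub_pos.2 (ho t ht))]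
      have e : (fun s => (-1) * G |x s p - x s k|) =ᶠ[𝓝 t]
          fun s => (-1) * (G ∘ (fun s => x s k - x s p)) s := by
        have hc := hd.continuousAt
        have : ∀ᶠ s in 𝓝 t, (0:ℝ) < x s k - x s p :=
          hc (Ioi_mem_nhds (show (0:ℝ) < x t k - x t p by linarith [ho t ht]))
        filter_upwards [this] with s hs
        rw [abs_sub_comm, abs_of_pos hs]; rfl
      refine (HasDerivAt.congr_of_eventuallyEq this e).congr_deriv ?_
      ring
    · have : p = k := by
        by_contra hne
        exact hsep 0 ⟨le_rfl, ht₀⟩ p k hne h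
      subst this
      simp only [sub_self, Real.sign_zero, zero_mul, mul_zero]
      exact hasDerivAt_const _ _
    · have ho := cs_order hx hsep h
      rw [Real.sign_of_pos (by linarith)]
      have hd := (hx p t ht).sub (hx k t ht)
      have hg := (hG (x t p - x t k) (by linarith [ho t ht]))
      have := (HasDerivAt.comp t hg hd).const_mul 1
      rw [abs_of_pos (sub_pos.2 (ho t ht))]
      have e : (fun s => 1 * G |x s p - x s k|) =ᶠ[𝓝 t]
          fun s => 1 * (G ∘ (fun s => x s p - x s k)) s := by
        have hc := hd.continuousAt
        have : ∀ᶠ s in 𝓝 t, (0:ℝ) < x s p - x s k :=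
          hc (Ioi_mem_nhds (show (0:ℝ) < x t p - x t k by linarith [ho t ht]))
        filter_upwards [this] with s hs
        rw [abs_of_pos hs]; rfl
      refine (HasDerivAt.congr_of_eventuallyEq this e).congr_deriv ?_
      ring
  set F : ℝ → ℝ := fun t =>
    v t p + (N : ℝ)⁻¹ * ∑ k, Real.sign (x 0 p - x 0 k) * G |x t p - x t k| with hF
  have hF' : ∀ t ∈ Ico (0 : ℝ) t₀, HasDerivAt F 0 t := by
    intro t ht
    have := (hv p t ht).add ((HasDerivAt.fun_sum (u := Finset.univ)
      (fun k _ => h1 k t ht)).const_mul (N : ℝ)⁻¹)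
    refine this.congr_deriv ?_
    rw [← mul_add, ← Finset.sum_add_distrib]
    rw [Finset.sum_eq_zero, mul_zero]
    intro k _; ring
  refine ⟨F 0, fun t ht => ?_⟩
  have hsub : ∀ s ∈ Icc 0 t, s ∈ Ico 0 t₀ := fun s hs => ⟨hs.1, hs.2.trans_lt ht.2⟩
  have := constant_of_has_deriv_right_zero (f := F) (a := 0) (b := t)
    (fun s hs => (hF' s (hsub s hs)).continuousAt.continuousWithinAt)
    (fun s hs => (hF' s (hsub s (Ico_subset_Icc_self hs))).hasDerivWithinAt) t ⟨ht.1, le_rfl⟩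
  rw [← this]; simp only [hF]; ring

lemma cs_part1 (hN : 0 < N) (hα : 1 ≤ α) (ht₀ : 0 < t₀)
    (hx : ∀ i, ∀ t ∈ Ico (0 : ℝ) t₀, HasDerivAt (fun s => x s i) (v t i) t)
    (hv : ∀ i, ∀ t ∈ Ico (0 : ℝ) t₀, HasDerivAt (fun s => v s i)
      ((N : ℝ)⁻¹ * ∑ j, (|x t i - x t j| ^ (-α)) * (v t j - v t i)) t)
    (hsep : ∀ t ∈ Ico (0 : ℝ) t₀, ∀ i j : Fin N, i ≠ j → x t i ≠ x t j)
    (xbar : Fin N → ℝ)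
    (hlim : ∀ i, Tendsto (fun t => x t i) (𝓝[<] t₀) (𝓝 (xbar i))) :
    ∀ i j : Fin N, i ≠ j → xbar i ≠ xbar j := by
  classical
  intro i j hij heq
  obtain ⟨G, hG, hG0⟩ := cs_primitive α hα
  set C : Finset (Fin N) := Finset.univ.filter (fun k => xbar k = xbar i) with hC
  have hiC : i ∈ C := by simp [hC]
  have hjC : j ∈ C := by simp [hC, heq]
  have h00 : (0:ℝ) ∈ Ico 0 t₀ := ⟨le_rfl, ht₀⟩
  obtain ⟨a, haC, ha⟩ := C.exists_min_image (x 0) ⟨i, hiC⟩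
  obtain ⟨b, hbC, hb⟩ := C.exists_max_image (x 0) ⟨i, hiC⟩
  have hab : a ≠ b := by
    rintro rfl
    apply hsep 0 h00 i j hij
    linarith [ha i hiC, hb i hiC, ha j hjC, hb j hjC]
  have ha' : ∀ k ∈ C, k ≠ a → x 0 a < x 0 k := fun k hk hne =>
    lt_of_le_of_ne (ha k hk) (hsep 0 h00 a k hne.symm)
  have hb' : ∀ k ∈ C, k ≠ b → x 0 k < x 0 b := fun k hk hne =>
    lt_of_le_of_ne (hb k hk) (hsep 0 h00 k b hne)
  have hxab : xbar a = xbar b := by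
    simp only [hC, Finset.mem_filter, Finset.mem_univ, true_and] at haC hbC
    rw [haC, hbC]
  have hIco : ∀ᶠ t in 𝓝[<] t₀, t ∈ Ico 0 t₀ :=
    mem_of_superset (Ioo_mem_nhdsLT ht₀) Ioo_subset_Ico_self
  -- limits of G terms
  have hbot : ∀ p ∈ C, ∀ k ∈ C, p ≠ k →
      Tendsto (fun t => G |x t p - x t k|) (𝓝[<] t₀) atBot := by
    intro p hp k hk hpk
    refine hG0.comp (tendsto_nhdsWithin_iff.2 ⟨?_, ?_⟩)
    · have := ((hlim p).sub (hlim k)).abs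
      simp only [hC, Finset.mem_filter, Finset.mem_univ, true_and] at hp hk
      simpa [hp, hk] using this
    · filter_upwards [hIco] with t ht
      exact abs_pos.2 (sub_ne_zero.2 (hsep t ht p k hpk))
  have hconv : ∀ p k (s : ℝ), xbar p ≠ xbar k → ∃ M, ∀ᶠ t in 𝓝[<] t₀,
      s * G |x t p - x t k| ≤ M := by
    intro p k s hne
    have h1 := ((hlim p).sub (hlim k)).abs
    have h2 := (((hG _ (abs_pos.2 (sub_ne_zero.2 hne))).continuousAt.tendsto).comp h1).const_mul s
    refine ⟨_, (h2.eventually (Iio_mem_nhds (lt_add_one _))).mono fun t ht => le_of_lt ht⟩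
  -- bounds above
  have hbd : ∀ k, ∃ M, ∀ᶠ t in 𝓝[<] t₀,
      Real.sign (x 0 b - x 0 k) * G |x t b - x t k| ≤ M := by
    intro k
    by_cases hk : k ∈ C
    · by_cases hkb : k = b
      · subst hkb; exact ⟨0, by simp⟩
      · refine ⟨0, ?_⟩
        rw [Real.sign_of_pos (by linarith [hb' k hk hkb])]
        filter_upwards [(hbot b hbC k hk (Ne.symm hkb)).eventually_le_atBot 0] with t ht
        linarith
    · refine hconv _ _ _ ?_
      simp only [hC, Finset.mem_filter, Finset.mem_univ, true_and] at hbC hk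
      rw [hbC]; exact fun h => hk h.symm
  have hbd2 : ∀ k, ∃ M, ∀ᶠ t in 𝓝[<] t₀,
      -Real.sign (x 0 a - x 0 k) * G |x t a - x t k| ≤ M := by
    intro k
    by_cases hk : k ∈ C
    · by_cases hkb : k = a
      · subst hkb; exact ⟨0, by simp⟩
      · refine ⟨0, ?_⟩
        rw [Real.sign_of_neg (by linarith [ha' k hk hkb])]
        filter_upwards [(hbot a haC k hk (Ne.symm hkb)).eventually_le_atBot 0] with t ht
        linarith
    · refine hconv _ _ _ ?_
      simp only [hC, Finset.mem_filter, Finset.mem_univ, true_and] at haC hk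
      rw [haC]; exact fun h => hk h.symm
  choose M hM using hbd
  choose M' hM' using hbd2
  obtain ⟨ca, hca⟩ := cs_conserved ht₀ hx hv hsep hG a
  obtain ⟨cb, hcb⟩ := cs_conserved ht₀ hx hv hsep hG b
  have hNpos : (0:ℝ) < N := by exact_mod_cast hN
  set L : ℝ := N * (cb - ca) - ∑ k ∈ Finset.univ.erase a, M k - ∑ k, M' k with hL
  have hev : ∀ᶠ t in 𝓝[<] t₀, t ∈ Ico 0 t₀ ∧ 0 ≤ v t b - v t a := by
    filter_upwards [hIco, eventually_all.2 hM, eventually_all.2 hM',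
      (hbot b hbC a haC hab.symm).eventually_le_atBot L] with t ht h1 h2 h3
    refine ⟨ht, ?_⟩
    rw [hca t ht, hcb t ht]
    have s1 : ∑ k, Real.sign (x 0 b - x 0 k) * G |x t b - x t k| ≤
        G |x t b - x t a| + ∑ k ∈ Finset.univ.erase a, M k := by
      rw [← Finset.add_sum_erase _ _ (Finset.mem_univ a)]
      rw [Real.sign_of_pos (show 0 < x 0 b - x 0 a by linarith [hb' a haC hab]), one_mul]
      gcongr with k hk
      exact h1 k
    have s2 : -∑ k, Real.sign (x 0 a - x 0 k) * G |x t a - x t k| ≤ ∑ k, M' k := by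
      rw [← Finset.sum_neg_distrib]
      gcongr with k hk
      linarith [h2 k]
    have s3 : (N:ℝ)⁻¹ * (∑ k, Real.sign (x 0 b - x 0 k) * G |x t b - x t k|
        - ∑ k, Real.sign (x 0 a - x 0 k) * G |x t a - x t k|) ≤ (N:ℝ)⁻¹ * (N * (cb - ca)) := by
      gcongr
      linarith
    rw [inv_mul_cancel_left₀ hNpos.ne'] at s3
    linarith
  obtain ⟨l, hl, hsub⟩ := mem_nhdsLT_iff_exists_Ico_subset.1 hev
  have hl' := hsub ⟨le_rfl, hl⟩
  have hpos : 0 < x l b - x l a := sub_pos.2 (cs_order hx hsep (hb' a haC hab) l hl'.1)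
  have hmono : MonotoneOn (fun t => x t b - x t a) (Ico l t₀) := by
    apply monotoneOn_of_deriv_nonneg (convex_Ico _ _)
    · intro t ht
      exact ((hx b t (hsub ht).1).sub (hx a t (hsub ht).1)).continuousAt.continuousWithinAt
    · intro t ht
      have ht := interior_subset ht
      exact ((hx b t (hsub ht).1).sub
        (hx a t (hsub ht).1)).differentiableAt.differentiableWithinAt
    · intro t ht
      have ht := interior_subset ht
      have := ((hx b t (hsub ht).1).sub (hx a t (hsub ht).1)).deriv
      have h2 := (hsub ht).2
      rw [← this] at h2
      exact h2
  have hge : x l b - x l a ≤ xbar b - xbar a := by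
    refine ge_of_tendsto ((hlim b).sub (hlim a)) ?_
    filter_upwards [Ioo_mem_nhdsLT hl] with t ht
    exact hmono ⟨le_rfl, hl⟩ (Ioo_subset_Ico_self ht) ht.1.le
  linarith

lemma cs_vbound
    (hv : ∀ i, ∀ t ∈ Ico (0 : ℝ) t₀, HasDerivAt (fun s => v s i)
      ((N : ℝ)⁻¹ * ∑ j, (|x t i - x t j| ^ (-α)) * (v t j - v t i)) t) :
    ∃ R : ℝ, 0 ≤ R ∧ ∀ t ∈ Ico (0 : ℝ) t₀, ∀ i, |v t i| ≤ R := by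
  have hd : ∀ t ∈ Ico (0 : ℝ) t₀, HasDerivAt (fun s => ∑ i, v s i ^ 2)
      (∑ i, 2 * v t i * ((N : ℝ)⁻¹ * ∑ j, (|x t i - x t j| ^ (-α)) * (v t j - v t i))) t := by
    intro t ht
    refine HasDerivAt.fun_sum (fun i _ => ?_)
    have := (hv i t ht).pow 2
    refine this.congr_deriv ?_
    norm_num
  have hneg : ∀ t, (∑ i, 2 * v t i *
      ((N : ℝ)⁻¹ * ∑ j, (|x t i - x t j| ^ (-α)) * (v t j - v t i))) ≤ 0 := by
    intro t
    have e1 : (∑ i, 2 * v t i * ((N : ℝ)⁻¹ * ∑ j, (|x t i - x t j| ^ (-α)) * (v t j - v t i)))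
        = (N : ℝ)⁻¹ * ((∑ i, ∑ j, (|x t i - x t j| ^ (-α)) * (v t j - v t i) * v t i) +
          ∑ i, ∑ j, (|x t i - x t j| ^ (-α)) * (v t j - v t i) * v t i) := by
      rw [← two_mul]
      simp only [Finset.mul_sum]
      refine Finset.sum_congr rfl fun i _ => Finset.sum_congr rfl fun j _ => ?_
      ring
    rw [e1]
    nth_rw 2 [Finset.sum_comm]
    rw [← Finset.sum_add_distrib]
    apply mul_nonpos_of_nonneg_of_nonpos (by positivity)
    refine Finset.sum_nonpos fun i _ => ?_
    rw [← Finset.sum_add_distrib]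
    refine Finset.sum_nonpos fun j _ => ?_
    rw [abs_sub_comm (x t j)]
    have : 0 ≤ |x t i - x t j| ^ (-α) := by positivity
    nlinarith [mul_nonneg this (sq_nonneg (v t i - v t j))]
  have hanti : AntitoneOn (fun s => ∑ i, v s i ^ 2) (Ico 0 t₀) := by
    apply antitoneOn_of_deriv_nonpos (convex_Ico _ _)
    · exact fun t ht => (hd t ht).continuousAt.continuousWithinAt
    · exact fun t ht => (hd t (interior_subset ht)).differentiableAt.differentiableWithinAt
    · intro t ht
      rw [(hd t (interior_subset ht)).deriv]; exact hneg t
  refine ⟨Real.sqrt (∑ i, v 0 i ^ 2), Real.sqrt_nonneg _, fun t ht i => ?_⟩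
  apply Real.abs_le_sqrt
  have h1 := hanti (show (0:ℝ) ∈ Ico 0 t₀ from ⟨le_rfl, ht.1.trans_lt ht.2⟩) ht ht.1
  refine le_trans ?_ h1
  exact Finset.single_le_sum (f := fun i => v t i ^ 2) (fun i _ => sq_nonneg _) (Finset.mem_univ i)

lemma cs_limits (hN : 0 < N) (hα : 1 ≤ α) (ht₀ : 0 < t₀)
    (hx : ∀ i, ∀ t ∈ Ico (0 : ℝ) t₀, HasDerivAt (fun s => x s i) (v t i) t)
    (hv : ∀ i, ∀ t ∈ Ico (0 : ℝ) t₀, HasDerivAt (fun s => v s i)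
      ((N : ℝ)⁻¹ * ∑ j, (|x t i - x t j| ^ (-α)) * (v t j - v t i)) t)
    (hsep : ∀ t ∈ Ico (0 : ℝ) t₀, ∀ i j : Fin N, i ≠ j → x t i ≠ x t j) :
    ∃ xbar vbar : Fin N → ℝ, (∀ i j : Fin N, i ≠ j → xbar i ≠ xbar j) ∧
      (∀ i, Tendsto (fun t => x t i) (𝓝[<] t₀) (𝓝 (xbar i))) ∧
      (∀ i, Tendsto (fun t => v t i) (𝓝[<] t₀) (𝓝 (vbar i))) := by
  obtain ⟨R, hR, hb⟩ := cs_vbound hv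
  have hIco : ∀ᶠ t in 𝓝[<] t₀, t ∈ Ico 0 t₀ :=
    mem_of_superset (Ioo_mem_nhdsLT ht₀) Ioo_subset_Ico_self
  have hxl : ∀ i, ∃ y, Tendsto (fun t => x t i) (𝓝[<] t₀) (𝓝 y) := by
    intro i
    have hlip : LipschitzOnWith ⟨R, hR⟩ (fun t => x t i) (Ico 0 t₀) := by
      apply (convex_Ico 0 t₀).lipschitzOnWith_of_nnnorm_hasDerivWithin_le
        (fun t ht => (hx i t ht).hasDerivWithinAt)
      intro t ht
      exact hb t ht i
    obtain ⟨g, hg, hge⟩ := hlip.extend_real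
    refine ⟨g t₀, (hg.continuous.tendsto t₀ |>.mono_left nhdsWithin_le_nhds).congr' ?_⟩
    filter_upwards [hIco] with t ht
    exact (hge ht).symm
  choose xbar hxbar using hxl
  have hd := cs_part1 hN hα ht₀ hx hv hsep xbar hxbar
  obtain ⟨G, hG, hG0⟩ := cs_primitive α hα
  have hvl : ∀ p, ∃ y, Tendsto (fun t => v t p) (𝓝[<] t₀) (𝓝 y) := by
    intro p
    obtain ⟨c, hc⟩ := cs_conserved ht₀ hx hv hsep hG p
    have hk : ∀ k, Tendsto (fun t => Real.sign (x 0 p - x 0 k) * G |x t p - x t k|) (𝓝[<] t₀)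
        (𝓝 (Real.sign (x 0 p - x 0 k) * G |xbar p - xbar k|)) := by
      intro k
      by_cases hpk : p = k
      · subst hpk; simp
      · have h1 := ((hxbar p).sub (hxbar k)).abs
        exact (((hG _ (abs_pos.2 (sub_ne_zero.2 (hd p k hpk)))).continuousAt.tendsto).comp
          h1).const_mul _
    have := ((tendsto_finsetSum Finset.univ (fun k _ => hk k)).const_mul (N:ℝ)⁻¹).const_sub c
    refine ⟨_, this.congr' ?_⟩
    filter_upwards [hIco] with t ht
    exact (hc t ht).symm
  choose vbar hvbar using hvl
  exact ⟨xbar, vbar, hd, hxbar, hvbar⟩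
end

noncomputable def csField (N : ℕ) (α : ℝ) (p : (Fin N → ℝ) × (Fin N → ℝ)) :
    (Fin N → ℝ) × (Fin N → ℝ) :=
  (p.2, fun i => (N : ℝ)⁻¹ * ∑ j, (|p.1 i - p.1 j| ^ (-α)) * (p.2 j - p.2 i))

def csDom (N : ℕ) : Set ((Fin N → ℝ) × (Fin N → ℝ)) :=
  {p | ∀ i j : Fin N, i ≠ j → p.1 i ≠ p.1 j}

lemma csDom_open (N : ℕ) : IsOpen (csDom N) := by
  simp only [csDom, ofPred_forall]
  refine isOpen_iInter_of_finite fun i => isOpen_iInter_of_finite fun j =>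
    isOpen_iInter_of_finite fun _ => ?_
  exact isOpen_ne_fun (by fun_prop) (by fun_prop)

lemma csField_smooth (N : ℕ) (α : ℝ) : ∀ y ∈ csDom N, ContDiffAt ℝ 1 (csField N α) y := by
  intro y hy
  refine contDiffAt_snd.prodMk (contDiffAt_pi.2 fun i => ?_)
  refine contDiffAt_const.mul (ContDiffAt.sum fun j _ => ?_)
  by_cases hij : i = j
  · subst hij; simpa using contDiffAt_const
  · have hne := sub_ne_zero.2 (hy i j hij)
    have h1 : ContDiffAt ℝ 1 (fun p : (Fin N → ℝ) × (Fin N → ℝ) => p.1 i - p.1 j) y := by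
      fun_prop
    have h2 : ContDiffAt ℝ 1 (fun p : (Fin N → ℝ) × (Fin N → ℝ) => p.2 j - p.2 i) y := by
      fun_prop
    exact ((h1.norm ℝ hne).rpow_const_of_ne (norm_ne_zero_iff.2 hne)).mul h2

lemma csField_hasDeriv {N : ℕ} {α : ℝ} {γ : ℝ → (Fin N → ℝ) × (Fin N → ℝ)} {t : ℝ} :
    HasDerivAt γ (csField N α (γ t)) t ↔
      (∀ i, HasDerivAt (fun s => (γ s).1 i) ((γ t).2 i) t) ∧
      (∀ i, HasDerivAt (fun s => (γ s).2 i)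
      ((N : ℝ)⁻¹ * ∑ j, (|(γ t).1 i - (γ t).1 j| ^ (-α)) * ((γ t).2 j - (γ t).2 i)) t) := by
  rw [← hasDerivAt_pi, ← hasDerivAt_pi]
  constructor
  · intro h
    exact ⟨h.fst, h.snd⟩
  · rintro ⟨h1, h2⟩
    exact h1.prodMk h2

end CSAux



/-- A global-in-time, collision-free solution of the one-dimensional Cucker–Smale system with
communication weight `ψ(s) = s^(-α)` and initial data `(x₀, v₀)`. -/
def IsGlobalCSSol1D (N : ℕ) (α : ℝ) (x₀ v₀ : Fin N → ℝ) (X V : ℝ → Fin N → ℝ) : Prop :=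
  X 0 = x₀ ∧ V 0 = v₀ ∧
  (∀ i, ∀ t : ℝ, 0 ≤ t → HasDerivAt (fun s => X s i) (V t i) t) ∧
  (∀ i, ∀ t : ℝ, 0 ≤ t → HasDerivAt (fun s => V s i)
      ((N : ℝ)⁻¹ * ∑ j, (|X t i - X t j| ^ (-α)) * (V t j - V t i)) t) ∧
  (∀ t : ℝ, 0 ≤ t → ∀ i j : Fin N, i ≠ j → X t i ≠ X t j)

/-- Let `d = 1` and `α ≥ 1`.  Suppose `(x, v)` is a `C¹` solution of the
Cucker–Smale system with singular communication weight `ψ(s) = s^(-α)` on `[0, t₀)` such that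
the initial positions are pairwise distinct and the positions remain pairwise distinct on
`[0, t₀)`.  Then `t₀` cannot be a first collision time: the continuous extensions `x̄` of the
trajectories to `t = t₀` still satisfy `x̄ i ≠ x̄ j` for all `i ≠ j`.  Consequently, for
pairwise distinct initial positions the system admits a unique smooth global solution whose
trajectories never collide in finite time. -/
theorem cucker_smale_no_first_collision_1d
    (N : ℕ) (hN : 0 < N) (α : ℝ) (hα : 1 ≤ α) (t₀ : ℝ) (ht₀ : 0 < t₀)
    (x v : ℝ → Fin N → ℝ)
    (hx : ∀ i, ∀ t ∈ Set.Ico (0 : ℝ) t₀, HasDerivAt (fun s => x s i) (v t i) t)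
    (hv : ∀ i, ∀ t ∈ Set.Ico (0 : ℝ) t₀, HasDerivAt (fun s => v s i)
      ((N : ℝ)⁻¹ * ∑ j, (|x t i - x t j| ^ (-α)) * (v t j - v t i)) t)
    (hsep0 : ∀ i j : Fin N, i ≠ j → x 0 i ≠ x 0 j)
    (hsep : ∀ t ∈ Set.Ico (0 : ℝ) t₀, ∀ i j : Fin N, i ≠ j → x t i ≠ x t j)
    (xbar : Fin N → ℝ)
    (hlim : ∀ i, Filter.Tendsto (fun t => x t i) (nhdsWithin t₀ (Set.Iio t₀)) (nhds (xbar i))) :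
    (∀ i j : Fin N, i ≠ j → xbar i ≠ xbar j) ∧
    (∀ x₀ v₀ : Fin N → ℝ, (∀ i j : Fin N, i ≠ j → x₀ i ≠ x₀ j) →
      ∃ X V : ℝ → Fin N → ℝ, IsGlobalCSSol1D N α x₀ v₀ X V ∧
        ∀ X' V' : ℝ → Fin N → ℝ, IsGlobalCSSol1D N α x₀ v₀ X' V' →
          ∀ t : ℝ, 0 ≤ t → X' t = X t ∧ V' t = V t) := by
  refine ⟨cs_part1 hN hα ht₀ hx hv hsep xbar hlim, ?_⟩
  intro x₀ v₀ h₀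
  obtain ⟨Γ, hΓ0, hΓ⟩ := csode_global (csDom_open N) (csField_smooth N α) (z := (x₀, v₀)) h₀ (by
    intro T hT γ hγ0 hγ
    obtain ⟨xb, vb, hd, h1, h2⟩ := cs_limits (x := fun t => (γ t).1) (v := fun t => (γ t).2)
      hN hα hT (fun i t ht => (csField_hasDeriv.1 (hγ t ht).1).1 i)
      (fun i t ht => (csField_hasDeriv.1 (hγ t ht).1).2 i) (fun t ht => (hγ t ht).2)
    exact ⟨(xb, vb), hd, (tendsto_pi_nhds.2 h1).prodMk_nhds (tendsto_pi_nhds.2 h2)⟩)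
  refine ⟨fun t => (Γ t).1, fun t => (Γ t).2, ⟨by simp [hΓ0], by simp [hΓ0],
    fun i t ht => (csField_hasDeriv.1 (hΓ t ht).1).1 i,
    fun i t ht => (csField_hasDeriv.1 (hΓ t ht).1).2 i, fun t ht => (hΓ t ht).2⟩, ?_⟩
  rintro X' V' ⟨hX0, hV0, hX, hV, hS⟩ t ht
  have := csode_unique (csField_smooth N α) (T := t + 1) (γ := fun t => (X' t, V' t)) (γ' := Γ)
    (fun s hs => ⟨csField_hasDeriv.2 ⟨fun i => hX i s hs.1, fun i => hV i s hs.1⟩, hS s hs.1⟩)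
    (fun s hs => hΓ s hs.1) (by simp [hΓ0, hX0, hV0]) t ⟨ht, by linarith⟩
  exact ⟨congrArg Prod.fst this, congrArg Prod.snd this⟩
end

section
/- Let α=2 and δ≥0, and let (x,v) be a solution of the δ-Cucker–Smale system on [0,T₀) with |x_i(t)−x_j(t)|>δ for all i≠j. Then for all t∈[0,T₀): |(1/N²) Σ_{i≠j} log(|x_i(t)−x_j(t)|−δ)| ≤ |(1/N²) Σ_{i≠j} log(|x_i(0)−x_j(0)|−δ)| + T₀/2 + (1/(2N)) Σ_{i=1}^N |v_i(0)|². -/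
/-- A nonpositive derivative on `[0, T)` forces `G t ≤ G 0`. -/
lemma le_of_deriv_nonpos_aux (T : ℝ) (G G' : ℝ → ℝ)
    (h : ∀ t ∈ Set.Ico (0 : ℝ) T, HasDerivAt G (G' t) t)
    (hn : ∀ t ∈ Set.Ico (0 : ℝ) T, G' t ≤ 0) :
    ∀ t ∈ Set.Ico (0 : ℝ) T, G t ≤ G 0 := by
  intro t ht
  have hsub : ∀ s ∈ Set.Icc (0 : ℝ) t, s ∈ Set.Ico (0 : ℝ) T :=
    fun s hs => ⟨hs.1, lt_of_le_of_lt hs.2 ht.2⟩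
  have ha : AntitoneOn G (Set.Icc 0 t) := by
    apply antitoneOn_of_deriv_nonpos (convex_Icc 0 t)
    · intro s hs
      exact (h s (hsub s hs)).continuousAt.continuousWithinAt
    · intro s hs
      exact (h s (hsub s (interior_subset hs))).differentiableAt.differentiableWithinAt
    · intro s hs
      rw [(h s (hsub s (interior_subset hs))).deriv]
      exact hn s (hsub s (interior_subset hs))
  exact ha ⟨le_rfl, ht.1⟩ ⟨ht.1, le_rfl⟩ ht.1

lemma hasDerivAt_log_norm_aux {E : Type*} [NormedAddCommGroup E] [InnerProductSpace ℝ E]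
    (y : ℝ → E) (y' : E) (t δ : ℝ) (hδ : 0 ≤ δ) (hy : HasDerivAt y y' t) (hs : δ < ‖y t‖) :
    HasDerivAt (fun s => Real.log (‖y s‖ - δ))
      (inner ℝ (y t) y' / (‖y t‖ * (‖y t‖ - δ))) t := by
  have hpos : 0 < ‖y t‖ := lt_of_le_of_lt hδ hs
  have h1 := hy.norm_sq
  have h2 := (h1.sqrt (by positivity)).sub_const δ
  have h3 : HasDerivAt (fun s => ‖y s‖ - δ)
      (2 * inner ℝ (y t) y' / (2 * √(‖y t‖ ^ 2))) t := by
    refine h2.congr_of_eventuallyEq (Filter.Eventually.of_forall fun s => ?_)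
    simp [Real.sqrt_sq (norm_nonneg (y s))]
  have h4 := h3.log (sub_pos.2 hs).ne'
  have hd : ‖y t‖ - δ ≠ 0 := (sub_pos.2 hs).ne'
  refine h4.congr_deriv ?_
  rw [Real.sqrt_sq hpos.le]
  field_simp

lemma abs_inner_div_le_aux {E : Type*} [NormedAddCommGroup E] [InnerProductSpace ℝ E]
    (y w : E) (δ : ℝ) (hδ : 0 ≤ δ) (hs : δ < ‖y‖) :
    |inner ℝ y w / (‖y‖ * (‖y‖ - δ))|
      ≤ 1 / 2 + (‖y‖ - δ) ^ (-(2 : ℝ)) * ‖w‖ ^ 2 / 2 := by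
  have hpos : 0 < ‖y‖ := lt_of_le_of_lt hδ hs
  have hd : 0 < ‖y‖ - δ := sub_pos.2 hs
  have hr : (‖y‖ - δ) ^ (-(2 : ℝ)) = ((‖y‖ - δ)⁻¹) ^ 2 := by
    rw [Real.rpow_neg hd.le, inv_pow]; norm_cast
  rw [hr, abs_div, abs_of_pos (mul_pos hpos hd)]
  have h1 : |inner ℝ y w| / (‖y‖ * (‖y‖ - δ)) ≤ ‖w‖ * (‖y‖ - δ)⁻¹ := by
    calc _ ≤ (‖y‖ * ‖w‖) / (‖y‖ * (‖y‖ - δ)) := by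
          gcongr
          exact abs_real_inner_le_norm y w
      _ = _ := by field_simp
  nlinarith [sq_nonneg (‖w‖ * (‖y‖ - δ)⁻¹ - 1)]

lemma sum_erase_comm_aux (N : ℕ) (f : Fin N → Fin N → ℝ) :
    ∑ i, ∑ j ∈ Finset.univ.erase i, f i j = ∑ i, ∑ j ∈ Finset.univ.erase i, f j i := by
  apply Finset.sum_comm'
  intro a b
  simp [eq_comm]

lemma dissipation_aux {E : Type*} [NormedAddCommGroup E] [InnerProductSpace ℝ E]
    (N : ℕ) (w : Fin N → E) (k : Fin N → Fin N → ℝ) (hk : ∀ i j, k i j = k j i) :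
    ∑ i, 2 * inner ℝ (w i) ((N : ℝ)⁻¹ • ∑ j ∈ Finset.univ.erase i, k i j • (w j - w i))
      = -((N : ℝ)⁻¹ * ∑ i, ∑ j ∈ Finset.univ.erase i, k i j * ‖w i - w j‖ ^ 2) := by
  have h1 : ∑ i, 2 * inner ℝ (w i) ((N : ℝ)⁻¹ • ∑ j ∈ Finset.univ.erase i, k i j • (w j - w i))
      = (N : ℝ)⁻¹ * (2 * ∑ i, ∑ j ∈ Finset.univ.erase i, k i j * inner ℝ (w i) (w j - w i)) := by
    simp only [inner_smul_right, inner_sum, Finset.mul_sum]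
    refine Finset.sum_congr rfl fun i _ => Finset.sum_congr rfl fun j _ => by ring
  rw [h1, ← mul_neg]
  congr 1
  rw [two_mul]
  nth_rewrite 2 [sum_erase_comm_aux]
  simp only [← Finset.sum_add_distrib, ← Finset.sum_neg_distrib]
  refine Finset.sum_congr rfl fun i _ => Finset.sum_congr rfl fun j _ => ?_
  rw [hk j i, norm_sub_sq_real, inner_sub_right, inner_sub_right, real_inner_self_eq_norm_sq,
    real_inner_self_eq_norm_sq, real_inner_comm (w i) (w j)]
  ring

/-- Let `α = 2` and `δ ≥ 0`, and let `(x, v)` be a solution of the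
`δ`-Cucker–Smale system on `[0, T₀)` with `‖x_i(t) − x_j(t)‖ > δ` for all `i ≠ j`.  Then for
all `t ∈ [0, T₀)`:
`|(1/N²) Σ_{i≠j} log(‖x_i(t) − x_j(t)‖ − δ)| ≤ |(1/N²) Σ_{i≠j} log(‖x_i(0) − x_j(0)‖ − δ)|
  + T₀/2 + (1/(2N)) Σ_i ‖v_i(0)‖²`. -/
theorem delta_cucker_smale_log_estimate
    (d N : ℕ) (hN : 0 < N) (δ : ℝ) (hδ : 0 ≤ δ) (T₀ : ℝ) (hT₀ : 0 < T₀)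
    (x v : ℝ → Fin N → EuclideanSpace ℝ (Fin d))
    (hx : ∀ i, ∀ t ∈ Set.Ico (0 : ℝ) T₀, HasDerivAt (fun s => x s i) (v t i) t)
    (hv : ∀ i, ∀ t ∈ Set.Ico (0 : ℝ) T₀, HasDerivAt (fun s => v s i)
      ((N : ℝ)⁻¹ • ∑ j ∈ Finset.univ.erase i,
        ((‖x t i - x t j‖ - δ) ^ (-(2 : ℝ))) • (v t j - v t i)) t)
    (hsep : ∀ t ∈ Set.Ico (0 : ℝ) T₀, ∀ i j : Fin N, i ≠ j → δ < ‖x t i - x t j‖) :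
    ∀ t ∈ Set.Ico (0 : ℝ) T₀,
      |((N : ℝ) ^ 2)⁻¹ * ∑ i, ∑ j ∈ Finset.univ.erase i, Real.log (‖x t i - x t j‖ - δ)|
        ≤ |((N : ℝ) ^ 2)⁻¹ * ∑ i, ∑ j ∈ Finset.univ.erase i, Real.log (‖x 0 i - x 0 j‖ - δ)|
          + T₀ / 2 + (2 * (N : ℝ))⁻¹ * ∑ i, ‖v 0 i‖ ^ 2 := by
  have hNpos : (0 : ℝ) < N := by exact_mod_cast hN
  set L : ℝ → ℝ := fun t =>
    ((N : ℝ) ^ 2)⁻¹ * ∑ i, ∑ j ∈ Finset.univ.erase i, Real.log (‖x t i - x t j‖ - δ) with hL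
  set K : ℝ → ℝ := fun t => (2 * (N : ℝ))⁻¹ * ∑ i, ‖v t i‖ ^ 2 with hK
  set L' : ℝ → ℝ := fun t =>
    ((N : ℝ) ^ 2)⁻¹ * ∑ i, ∑ j ∈ Finset.univ.erase i,
      (inner ℝ (x t i - x t j) (v t i - v t j)
        / (‖x t i - x t j‖ * (‖x t i - x t j‖ - δ))) with hL'
  set D : ℝ → ℝ := fun t => ∑ i, ∑ j ∈ Finset.univ.erase i,
      (‖x t i - x t j‖ - δ) ^ (-(2 : ℝ)) * ‖v t i - v t j‖ ^ 2 with hD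
  have dL : ∀ t ∈ Set.Ico (0 : ℝ) T₀, HasDerivAt L (L' t) t := by
    intro t ht
    refine HasDerivAt.const_mul _ (HasDerivAt.fun_sum fun i _ => HasDerivAt.fun_sum fun j hj => ?_)
    exact hasDerivAt_log_norm_aux (fun s => x s i - x s j) _ t δ hδ
      ((hx i t ht).sub (hx j t ht)) (hsep t ht i j (Finset.ne_of_mem_erase hj).symm)
  have dK : ∀ t ∈ Set.Ico (0 : ℝ) T₀, HasDerivAt K (-(((N : ℝ) ^ 2)⁻¹ * (D t / 2))) t := by
    intro t ht
    have h := HasDerivAt.const_mul (2 * (N : ℝ))⁻¹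
      (HasDerivAt.fun_sum (u := Finset.univ) fun i _ => (hv i t ht).norm_sq)
    refine h.congr_deriv ?_
    rw [dissipation_aux N (v t) (fun i j => (‖x t i - x t j‖ - δ) ^ (-(2 : ℝ)))
      (fun i j => by rw [norm_sub_rev])]
    simp only [hD]
    field_simp
  have bL : ∀ t ∈ Set.Ico (0 : ℝ) T₀, |L' t| ≤ 1 / 2 + ((N : ℝ) ^ 2)⁻¹ * (D t / 2) := by
    intro t ht
    have h1 : |∑ i, ∑ j ∈ Finset.univ.erase i,
      (inner ℝ (x t i - x t j) (v t i - v t j)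
        / (‖x t i - x t j‖ * (‖x t i - x t j‖ - δ)))| ≤
        ∑ i : Fin N, ∑ j ∈ Finset.univ.erase i, (1 / 2 +
          (‖x t i - x t j‖ - δ) ^ (-(2 : ℝ)) * ‖v t i - v t j‖ ^ 2 / 2) := by
      refine (Finset.abs_sum_le_sum_abs _ _).trans (Finset.sum_le_sum fun i _ => ?_)
      refine (Finset.abs_sum_le_sum_abs _ _).trans (Finset.sum_le_sum fun j hj => ?_)
      exact abs_inner_div_le_aux _ _ δ hδ (hsep t ht i j (Finset.ne_of_mem_erase hj).symm)
    have h2 : ∑ i : Fin N, ∑ j ∈ Finset.univ.erase i, (1 / 2 +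
          (‖x t i - x t j‖ - δ) ^ (-(2 : ℝ)) * ‖v t i - v t j‖ ^ 2 / 2)
          ≤ (N : ℝ) ^ 2 / 2 + D t / 2 := by
      simp only [Finset.sum_add_distrib, hD, Finset.sum_div]
      refine add_le_add ?_ le_rfl
      have : ∀ i : Fin N, ∑ j ∈ Finset.univ.erase i, (1 / 2 : ℝ) ≤ (N : ℝ) / 2 := by
        intro i
        calc _ ≤ ∑ j : Fin N, (1 / 2 : ℝ) :=
              Finset.sum_le_sum_of_subset_of_nonneg (Finset.erase_subset _ _)
                (fun _ _ _ => by norm_num)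
          _ = _ := by simp; ring
      refine (Finset.sum_le_sum fun i _ => this i).trans (le_of_eq ?_)
      simp; ring
    simp only [hL', abs_mul]
    rw [abs_of_pos (by positivity : (0 : ℝ) < ((N : ℝ) ^ 2)⁻¹)]
    calc _ ≤ ((N : ℝ) ^ 2)⁻¹ * ((N : ℝ) ^ 2 / 2 + D t / 2) := by
          gcongr
          exact h1.trans h2
      _ = _ := by field_simp
  intro t ht
  have hKt : 0 ≤ K t := by simp only [hK]; positivity
  have u1 := le_of_deriv_nonpos_aux T₀ (fun s => L s + K s - s * (1 / 2)) _
    (fun s hs => ((dL s hs).add (dK s hs)).sub ((hasDerivAt_id s).mul_const (1 / 2)))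
    (fun s hs => by have := (abs_le.1 (bL s hs)).2; linarith) t ht
  have u2 := le_of_deriv_nonpos_aux T₀ (fun s => K s - L s - s * (1 / 2)) _
    (fun s hs => ((dK s hs).sub (dL s hs)).sub ((hasDerivAt_id s).mul_const (1 / 2)))
    (fun s hs => by have := (abs_le.1 (bL s hs)).1; linarith) t ht
  have ht2 := ht.2
  change |L t| ≤ |L 0| + T₀ / 2 + K 0
  have a1 := le_abs_self (L 0)
  have a2 := neg_abs_le (L 0)
  rw [abs_le]
  constructor <;> linarith
end

section
/- Let α>2 and δ≥0, and let (x,v) be a solution of the δ-Cucker–Smale system on [0,T₀) with |x_i(t)−x_j(t)|>δ for all i≠j. Define L^{α−2}(t) := (1/N²) Σ_{i≠j} (|x_i(t)−x_j(t)|−δ)^{−(α−2)}. Then there exists a constant C>0 depending only on α such that for all t∈[0,T₀): L^{α−2}(t) ≤ L^{α−2}(0)·e^{Ct} + C·e^{Ct}·(1/N) Σ_{i=1}^N |v_i(0)|². -/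
open Finset in
lemma dcs_swap {N : ℕ} (f : Fin N → Fin N → ℝ) :
    ∑ i, ∑ j ∈ univ.erase i, f i j = ∑ i, ∑ j ∈ univ.erase i, f j i := by
  apply Finset.sum_comm'
  intro a b
  simp [eq_comm]

lemma dcs_norm {d : ℕ} {f : ℝ → EuclideanSpace ℝ (Fin d)} {f' : EuclideanSpace ℝ (Fin d)} {t : ℝ}
    (hf : HasDerivAt f f' t) (h0 : 0 < ‖f t‖) :
    HasDerivAt (fun s => ‖f s‖) (inner ℝ (f t) f' / ‖f t‖) t := by
  have h := (hf.norm_sq).sqrt (by positivity)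
  simp only [Real.sqrt_sq (norm_nonneg _)] at h
  convert h using 1
  field_simp

lemma dcs_amgm (α r w p : ℝ) (hα : 2 < α) (hr : 0 < r) (hp : |p| ≤ w) :
    p * (-(α - 2)) * r ^ (-(α - 2) - 1)
      ≤ (α - 2) * (r ^ (-α) * w ^ 2) + (α - 2) * r ^ (-(α - 2)) := by
  have e1 : r ^ (-(α - 2) - 1) = r ^ (-α) * r := by
    rw [← Real.rpow_add_one hr.ne']; congr 1; ring
  have e2 : r ^ (-(α - 2)) = r ^ (-α) * r ^ 2 := by
    rw [← Real.rpow_add_natCast hr.ne']; congr 1; push_cast; ring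
  rw [e1, e2]
  have hk : 0 ≤ (α - 2) * r ^ (-α) := mul_nonneg (by linarith) (by positivity)
  have hq : -(p * r) ≤ w ^ 2 + r ^ 2 := by
    have := (abs_le.1 hp).1
    nlinarith [sq_nonneg (w - r), sq_nonneg w, sq_nonneg r]
  nlinarith [mul_le_mul_of_nonneg_left hq hk]

open Finset in
lemma dcs_energy {d N : ℕ} (ψ : Fin N → Fin N → ℝ) (hψ : ∀ i j, ψ i j = ψ j i)
    (v : Fin N → EuclideanSpace ℝ (Fin d)) :
    ∑ i, 2 * inner ℝ (v i) ((N : ℝ)⁻¹ • ∑ j ∈ univ.erase i, ψ i j • (v j - v i))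
      = - ((N : ℝ)⁻¹ * ∑ i, ∑ j ∈ univ.erase i, ψ i j * ‖v i - v j‖ ^ 2) := by
  have h1 : ∑ i, 2 * inner ℝ (v i) ((N : ℝ)⁻¹ • ∑ j ∈ univ.erase i, ψ i j • (v j - v i))
      = (N : ℝ)⁻¹ * (2 * ∑ i, ∑ j ∈ univ.erase i, ψ i j * inner ℝ (v i) (v j - v i)) := by
    simp only [inner_smul_right, inner_sum, mul_sum]
    refine sum_congr rfl fun i _ => sum_congr rfl fun j _ => by ring
  have h2 := dcs_swap (fun i j => ψ i j * inner ℝ (v i) (v j - v i))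
  have h3 : 2 * ∑ i, ∑ j ∈ univ.erase i, ψ i j * inner ℝ (v i) (v j - v i)
      = - ∑ i, ∑ j ∈ univ.erase i, ψ i j * ‖v i - v j‖ ^ 2 := by
    rw [two_mul]
    nth_rewrite 2 [h2]
    simp only [← sum_add_distrib, ← sum_neg_distrib]
    refine sum_congr rfl fun i _ => sum_congr rfl fun j _ => ?_
    rw [hψ j i, ← real_inner_self_eq_norm_sq]
    simp only [inner_sub_left, inner_sub_right]
    ring
  rw [h1, h3, mul_neg]

/-- Let `α > 2` and `δ ≥ 0`, and let `(x, v)` be a solution of the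
`δ`-Cucker–Smale system on `[0, T₀)` with `‖x_i(t) − x_j(t)‖ > δ` for all `i ≠ j`.  Define
`L^{α−2}(t) := (1/N²) Σ_{i≠j} (‖x_i(t) − x_j(t)‖ − δ)^{−(α−2)}`.  Then there exists a constant
`C > 0`, depending only on `α`, such that for all `t ∈ [0, T₀)`:
`L^{α−2}(t) ≤ L^{α−2}(0)·e^{Ct} + C·e^{Ct}·(1/N) Σ_i ‖v_i(0)‖²`. -/
theorem delta_cucker_smale_uniform_estimate (α : ℝ) (hα : 2 < α) :
    ∃ C > (0 : ℝ), ∀ (d N : ℕ), 0 < N → ∀ δ : ℝ, 0 ≤ δ → ∀ T₀ : ℝ, 0 < T₀ →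
      ∀ x v : ℝ → Fin N → EuclideanSpace ℝ (Fin d),
        (∀ i, ∀ t ∈ Set.Ico (0 : ℝ) T₀, HasDerivAt (fun s => x s i) (v t i) t) →
        (∀ i, ∀ t ∈ Set.Ico (0 : ℝ) T₀, HasDerivAt (fun s => v s i)
          ((N : ℝ)⁻¹ • ∑ j ∈ Finset.univ.erase i,
            ((‖x t i - x t j‖ - δ) ^ (-α)) • (v t j - v t i)) t) →
        (∀ t ∈ Set.Ico (0 : ℝ) T₀, ∀ i j : Fin N, i ≠ j → δ < ‖x t i - x t j‖) →
        ∀ t ∈ Set.Ico (0 : ℝ) T₀,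
          ((N : ℝ) ^ 2)⁻¹ * ∑ i, ∑ j ∈ Finset.univ.erase i,
              (‖x t i - x t j‖ - δ) ^ (-(α - 2))
            ≤ (((N : ℝ) ^ 2)⁻¹ * ∑ i, ∑ j ∈ Finset.univ.erase i,
                (‖x 0 i - x 0 j‖ - δ) ^ (-(α - 2))) * Real.exp (C * t)
              + C * Real.exp (C * t) * ((N : ℝ)⁻¹ * ∑ i, ‖v 0 i‖ ^ 2) := by
  refine ⟨α - 2, by linarith, ?_⟩
  intro d N hN δ hδ T₀ hT x v hx hv hsep t ht
  set C := α - 2 with hC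
  have hCpos : 0 < C := by rw [hC]; linarith
  have hNpos : (0 : ℝ) < N := by exact_mod_cast hN
  let L : ℝ → ℝ := fun s => ((N : ℝ) ^ 2)⁻¹ * ∑ i, ∑ j ∈ Finset.univ.erase i,
              (‖x s i - x s j‖ - δ) ^ (-C)
  let E : ℝ → ℝ := fun s => (N : ℝ)⁻¹ * ∑ i, ‖v s i‖ ^ 2
  let D : ℝ → ℝ := fun s => ((N : ℝ) ^ 2)⁻¹ * ∑ i, ∑ j ∈ Finset.univ.erase i,
              (‖x s i - x s j‖ - δ) ^ (-α) * ‖v s i - v s j‖ ^ 2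
  have hE0 : ∀ s, 0 ≤ E s := fun s => by positivity
  have hE : ∀ s ∈ Set.Ico (0 : ℝ) T₀, HasDerivAt E (-D s) s := by
    intro s hs
    have h1 := (HasDerivAt.fun_sum (u := Finset.univ)
      (fun i _ => (hv i s hs).norm_sq)).const_mul ((N : ℝ)⁻¹)
    have h2 := dcs_energy (fun i j => (‖x s i - x s j‖ - δ) ^ (-α))
      (fun i j => by rw [norm_sub_rev]) (v s)
    rw [h2] at h1
    refine h1.congr_deriv ?_
    simp only [D]
    field_simp
  have hL : ∀ s ∈ Set.Ico (0 : ℝ) T₀, ∃ L', HasDerivAt L L' s ∧ L' ≤ C * D s + C * L s := by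
    intro s hs
    have h1 : ∀ i, ∀ j ∈ Finset.univ.erase i, HasDerivAt
        (fun s => (‖x s i - x s j‖ - δ) ^ (-C))
        (inner ℝ (x s i - x s j) (v s i - v s j) / ‖x s i - x s j‖ * (-C)
          * (‖x s i - x s j‖ - δ) ^ (-C - 1)) s := by
      intro i j hj
      have hlt := hsep s hs i j (Finset.ne_of_mem_erase hj).symm
      have h := dcs_norm ((hx i s hs).fun_sub (hx j s hs)) (lt_of_le_of_lt hδ hlt)
      exact (h.sub_const δ).rpow_const (Or.inl (by linarith [hlt]))
    refine ⟨_, (HasDerivAt.fun_sum (u := Finset.univ) (fun i _ =>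
      HasDerivAt.fun_sum (h1 i))).const_mul _, ?_⟩
    have h4 : C * D s + C * L s = ((N : ℝ) ^ 2)⁻¹ * ∑ i, ∑ j ∈ Finset.univ.erase i,
        (C * ((‖x s i - x s j‖ - δ) ^ (-α) * ‖v s i - v s j‖ ^ 2)
          + C * (‖x s i - x s j‖ - δ) ^ (-C)) := by
      simp only [D, L, Finset.sum_add_distrib, ← Finset.mul_sum]
      ring
    rw [h4]
    refine mul_le_mul_of_nonneg_left ?_ (by positivity)
    refine Finset.sum_le_sum fun i _ => Finset.sum_le_sum fun j hj => ?_
    have hlt := hsep s hs i j (Finset.ne_of_mem_erase hj).symm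
    refine dcs_amgm α _ _ _ hα (by linarith) ?_
    have hp : 0 < ‖x s i - x s j‖ := lt_of_le_of_lt hδ hlt
    rw [abs_div, abs_norm, div_le_iff₀ hp, mul_comm]
    exact abs_real_inner_le_norm _ _
  let G : ℝ → ℝ := fun s => (L s + C * E s) * Real.exp (-(C * s))
  have hG : ∀ s ∈ Set.Ico (0 : ℝ) T₀, ∃ G', HasDerivAt G G' s ∧ G' ≤ 0 := by
    intro s hs
    obtain ⟨L', hL', hle⟩ := hL s hs
    have he : HasDerivAt (fun s => Real.exp (-(C * s))) (Real.exp (-(C * s)) * -(C * 1)) s :=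
      (((hasDerivAt_id s).const_mul C).neg).exp
    refine ⟨_, (hL'.add ((hE s hs).const_mul C)).mul he, ?_⟩
    have hex := Real.exp_pos (-(C * s))
    have hb : L' + C * -D s - C * (L s + C * E s) ≤ 0 := by
      have : 0 ≤ C * (C * E s) := mul_nonneg hCpos.le (mul_nonneg hCpos.le (hE0 s))
      linarith
    have := mul_nonpos_of_nonpos_of_nonneg hb hex.le
    simp only [Pi.add_apply]
    linarith
  have hanti : AntitoneOn G (Set.Ico 0 T₀) := by
    refine antitoneOn_of_deriv_nonpos (convex_Ico 0 T₀) ?_ ?_ ?_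
    · intro s hs
      obtain ⟨_, h, _⟩ := hG s hs
      exact h.continuousAt.continuousWithinAt
    · intro s hs
      obtain ⟨_, h, _⟩ := hG s (interior_subset hs)
      exact h.differentiableAt.differentiableWithinAt
    · intro s hs
      obtain ⟨_, h, h'⟩ := hG s (interior_subset hs)
      rw [h.deriv]; exact h'
  have hfin := hanti ⟨le_refl 0, hT⟩ ht ht.1
  simp only [G, mul_zero, Real.exp_zero, Real.exp_neg, inv_one, mul_one] at hfin
  rw [← div_eq_mul_inv, div_le_iff₀ (Real.exp_pos _)] at hfin
  have := mul_nonneg hCpos.le (hE0 t)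
  change L t ≤ L 0 * Real.exp (C * t) + C * Real.exp (C * t) * E 0
  linarith
end

section
/- Let S ⊂ {1,…,N} and suppose x_i, v_i ∈ ℝ^d (1≤i≤N) satisfy: |v_k−v_j| ≤ 2M for all j,k; |x_i−x_k| ≥ δ > 0 and |x_j−x_k| ≥ δ for all i,j∈S and k∉S; and ψ : (0,∞)→[0,∞) is Lipschitz on (δ,∞) with Lipschitz constant L(δ). Then (2/N) Σ_{i,j∈S, k∉S} [ ψ(|x_i−x_k|)(v_i−v_j)·(v_k−v_i) − ψ(|x_j−x_k|)(v_i−v_j)·(v_k−v_j) ] ≤ 2c₁ ‖v‖_S ‖x‖_S, where c₁ := 2ML(δ)(N−|S|)/N, ‖x‖_S := sqrt( Σ_{i,j∈S} |x_i−x_j|² ) and ‖v‖_S := sqrt( Σ_{i,j∈S} |v_i−v_j|² ). -/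
open scoped RealInnerProductSpace

/-- Let `S ⊆ {1, …, N}` and suppose `x_i, v_i ∈ ℝ^d` satisfy
`‖v_k − v_j‖ ≤ 2M` for all `j, k`; `‖x_i − x_k‖ ≥ δ > 0` for all `i ∈ S` and `k ∉ S`; and
`ψ : (0, ∞) → [0, ∞)` is Lipschitz on `(δ, ∞)` with Lipschitz constant `L(δ)`.  Then
`(2/N) Σ_{i,j∈S, k∉S} [ψ(‖x_i − x_k‖)(v_i − v_j)·(v_k − v_i)
  − ψ(‖x_j − x_k‖)(v_i − v_j)·(v_k − v_j)] ≤ 2c₁ ‖v‖_S ‖x‖_S`,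
where `c₁ := 2ML(δ)(N − |S|)/N`. -/
theorem cross_group_interaction_bound
    (d N : ℕ) (hN : 0 < N) (S : Finset (Fin N))
    (x v : Fin N → EuclideanSpace ℝ (Fin d))
    (M δ L : ℝ) (hδ : 0 < δ)
    (hM : ∀ j k : Fin N, ‖v k - v j‖ ≤ 2 * M)
    (hsep : ∀ i ∈ S, ∀ k ∉ S, δ ≤ ‖x i - x k‖)
    (ψ : ℝ → ℝ) (hψ0 : ∀ s : ℝ, 0 < s → 0 ≤ ψ s)
    (hLip : ∀ a b : ℝ, δ ≤ a → δ ≤ b → |ψ a - ψ b| ≤ L * |a - b|) :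
    (2 / (N : ℝ)) * ∑ i ∈ S, ∑ j ∈ S, ∑ k ∈ Sᶜ,
        (ψ ‖x i - x k‖ * ⟪v i - v j, v k - v i⟫ - ψ ‖x j - x k‖ * ⟪v i - v j, v k - v j⟫)
      ≤ 2 * (2 * M * L * ((N : ℝ) - S.card) / N) *
          Real.sqrt (∑ i ∈ S, ∑ j ∈ S, ‖v i - v j‖ ^ 2) *
          Real.sqrt (∑ i ∈ S, ∑ j ∈ S, ‖x i - x j‖ ^ 2) := by
  have hL : 0 ≤ L := by
    have h := hLip (δ + 1) δ (by linarith) le_rfl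
    have h2 := (abs_nonneg _).trans h
    simpa using h2
  have hM0 : 0 ≤ 2 * M := (norm_nonneg _).trans (hM ⟨0, hN⟩ ⟨0, hN⟩)
  have hNr : (0 : ℝ) < N := by exact_mod_cast hN
  have hterm : ∀ i ∈ S, ∀ j ∈ S, ∀ k ∈ Sᶜ,
      (ψ ‖x i - x k‖ * ⟪v i - v j, v k - v i⟫ - ψ ‖x j - x k‖ * ⟪v i - v j, v k - v j⟫)
        ≤ 2 * M * L * (‖v i - v j‖ * ‖x i - x j‖) := by
    intro i hi j hj k hk
    have hk' : k ∉ S := Finset.mem_compl.mp hk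
    have h1 := hsep i hi k hk'
    have h2 := hsep j hj k hk'
    have hb := hψ0 ‖x j - x k‖ (by linarith)
    have hl := hLip _ _ h1 h2
    have htri : |‖x i - x k‖ - ‖x j - x k‖| ≤ ‖x i - x j‖ := by
      have := abs_norm_sub_norm_le (x i - x k) (x j - x k)
      rwa [sub_sub_sub_cancel_right] at this
    have hl2 : |ψ ‖x i - x k‖ - ψ ‖x j - x k‖| ≤ L * ‖x i - x j‖ :=
      hl.trans (mul_le_mul_of_nonneg_left htri hL)
    have hin : |⟪v i - v j, v k - v i⟫| ≤ ‖v i - v j‖ * (2 * M) :=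
      (abs_real_inner_le_norm _ _).trans
        (mul_le_mul_of_nonneg_left (hM i k) (norm_nonneg _))
    have hw : ⟪v i - v j, v k - v j⟫ = ⟪v i - v j, v k - v i⟫ + ‖v i - v j‖ ^ 2 := by
      rw [← real_inner_self_eq_norm_sq, ← inner_add_right, sub_add_sub_cancel]
    have hp : (ψ ‖x i - x k‖ - ψ ‖x j - x k‖) * ⟪v i - v j, v k - v i⟫
        ≤ (L * ‖x i - x j‖) * (‖v i - v j‖ * (2 * M)) := by
      refine (le_abs_self _).trans ?_
      rw [abs_mul]
      exact mul_le_mul hl2 hin (abs_nonneg _) (by positivity)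
    have hq : 0 ≤ ψ ‖x j - x k‖ * ‖v i - v j‖ ^ 2 := by positivity
    rw [hw]
    linarith
  have hcard : ((Sᶜ).card : ℝ) = (N : ℝ) - S.card := by
    rw [Finset.card_compl, Fintype.card_fin, Nat.cast_sub]
    simpa using Finset.card_le_univ S
  have hc0 : 0 ≤ (N : ℝ) - S.card := by rw [← hcard]; positivity
  have hCS : ∑ i ∈ S, ∑ j ∈ S, ‖v i - v j‖ * ‖x i - x j‖ ≤
      Real.sqrt (∑ i ∈ S, ∑ j ∈ S, ‖v i - v j‖ ^ 2) *
          Real.sqrt (∑ i ∈ S, ∑ j ∈ S, ‖x i - x j‖ ^ 2) := by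
    simp only [← Finset.sum_product']
    exact Real.sum_mul_le_sqrt_mul_sqrt _ _ _
  have hsum : ∑ i ∈ S, ∑ j ∈ S, ∑ k ∈ Sᶜ,
        (ψ ‖x i - x k‖ * ⟪v i - v j, v k - v i⟫ - ψ ‖x j - x k‖ * ⟪v i - v j, v k - v j⟫)
      ≤ ((N : ℝ) - S.card) * (2 * M * L) * ∑ i ∈ S, ∑ j ∈ S, ‖v i - v j‖ * ‖x i - x j‖ := by
    simp only [Finset.mul_sum]
    refine Finset.sum_le_sum fun i hi => Finset.sum_le_sum fun j hj => ?_
    refine (Finset.sum_le_sum (hterm i hi j hj)).trans ?_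
    rw [Finset.sum_const, nsmul_eq_mul, hcard]
    exact le_of_eq (by ring)
  have hfin := hsum.trans (mul_le_mul_of_nonneg_left hCS (mul_nonneg hc0 (mul_nonneg hM0 hL)))
  refine (mul_le_mul_of_nonneg_left hfin (by positivity : 0 ≤ 2 / (N : ℝ))).trans (le_of_eq ?_)
  ring
end

section
/- Let a : [s,t] → [0,∞) be continuous and c₀ > 0. Then ∫ₛᵗ ( ∫ₛ^τ e^{c₀ ∫ₛ^σ a(ρ)dρ} dσ ) a(τ) e^{−c₀ ∫ₛ^τ a(σ)dσ} dτ ≤ (t−s)/c₀. -/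
theorem iterated_aux (s t : ℝ) (hst : s ≤ t) (b : ℝ → ℝ) (c₀ : ℝ) (hc₀ : 0 < c₀)
    (hb : Continuous b) :
    (∫ τ in s..t, (∫ σ in s..τ, Real.exp (c₀ * ∫ ρ in s..σ, b ρ)) *
        (b τ * Real.exp (-c₀ * ∫ σ in s..τ, b σ)))
      ≤ (t - s) / c₀ := by
  have hA : ∀ x, HasDerivAt (fun τ => ∫ ρ in s..τ, b ρ) (b x) x := fun x =>
    intervalIntegral.integral_hasDerivAt_right (hb.intervalIntegrable _ _)
      (hb.stronglyMeasurableAtFilter _ _) hb.continuousAt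
  have hAc : Continuous (fun τ => ∫ ρ in s..τ, b ρ) :=
    continuous_iff_continuousAt.2 fun x => (hA x).continuousAt
  have hec : Continuous (fun σ => Real.exp (c₀ * ∫ ρ in s..σ, b ρ)) :=
    Real.continuous_exp.comp (continuous_const.mul hAc)
  have hE : ∀ x, HasDerivAt (fun τ => ∫ σ in s..τ, Real.exp (c₀ * ∫ ρ in s..σ, b ρ))
      (Real.exp (c₀ * ∫ ρ in s..x, b ρ)) x := fun x =>
    intervalIntegral.integral_hasDerivAt_right (hec.intervalIntegrable _ _)
      (hec.stronglyMeasurableAtFilter _ _) hec.continuousAt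
  have hEc : Continuous (fun τ => ∫ σ in s..τ, Real.exp (c₀ * ∫ ρ in s..σ, b ρ)) :=
    continuous_iff_continuousAt.2 fun x => (hE x).continuousAt
  have hnc : Continuous (fun σ => Real.exp (-c₀ * ∫ ρ in s..σ, b ρ)) :=
    Real.continuous_exp.comp (continuous_const.mul hAc)
  have hF : ∀ x, HasDerivAt (fun τ => ((τ - s) -
      (∫ σ in s..τ, Real.exp (c₀ * ∫ ρ in s..σ, b ρ)) *
        Real.exp (-c₀ * ∫ σ in s..τ, b σ)) / c₀)
      ((∫ σ in s..x, Real.exp (c₀ * ∫ ρ in s..σ, b ρ)) *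
        (b x * Real.exp (-c₀ * ∫ σ in s..x, b σ))) x := by
    intro x
    have h := (((hasDerivAt_id x).sub_const s).sub
      ((hE x).mul ((hA x).const_mul (-c₀)).exp)).div_const c₀
    refine h.congr_deriv ?_
    have h1 : Real.exp (c₀ * ∫ ρ in s..x, b ρ) * Real.exp (-c₀ * ∫ ρ in s..x, b ρ) = 1 := by
      rw [← Real.exp_add, neg_mul, add_neg_cancel, Real.exp_zero]
    rw [h1]
    field_simp
    ring
  rw [intervalIntegral.integral_eq_sub_of_hasDerivAt (fun x _ => hF x)
    ((hEc.mul (hb.mul hnc)).intervalIntegrable _ _)]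
  have hpos : 0 ≤ (∫ σ in s..t, Real.exp (c₀ * ∫ ρ in s..σ, b ρ)) *
        Real.exp (-c₀ * ∫ σ in s..t, b σ) :=
    mul_nonneg (intervalIntegral.integral_nonneg hst fun _ _ => (Real.exp_pos _).le)
      (Real.exp_pos _).le
  simp only [intervalIntegral.integral_same, sub_self, zero_mul, zero_div, sub_zero]
  refine div_le_div_of_nonneg_right ?_ hc₀.le
  linarith

/-- Let `a : [s, t] → [0, ∞)` be continuous and `c₀ > 0`.  Then
`∫ₛᵗ (∫ₛ^τ e^{c₀ ∫ₛ^σ a} dσ) a(τ) e^{−c₀ ∫ₛ^τ a} dτ ≤ (t − s)/c₀`. -/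
theorem iterated_exponential_integral_bound
    (s t : ℝ) (hst : s ≤ t) (a : ℝ → ℝ) (c₀ : ℝ) (hc₀ : 0 < c₀)
    (ha_cont : ContinuousOn a (Set.Icc s t))
    (ha_nonneg : ∀ τ ∈ Set.Icc s t, 0 ≤ a τ) :
    (∫ τ in s..t, (∫ σ in s..τ, Real.exp (c₀ * ∫ ρ in s..σ, a ρ)) *
        (a τ * Real.exp (-c₀ * ∫ σ in s..τ, a σ)))
      ≤ (t - s) / c₀ := by
  have hb : Continuous (Set.IccExtend hst ((Set.Icc s t).domRestrict a)) :=
    (continuousOn_iff_continuous_domRestrict.1 ha_cont).Icc_extend'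
  have hab : ∀ x ∈ Set.Icc s t, a x = Set.IccExtend hst ((Set.Icc s t).domRestrict a) x := by
    intro x hx
    rw [Set.IccExtend_of_mem _ _ hx]
    rfl
  have hA : ∀ x ∈ Set.Icc s t, (∫ ρ in s..x, a ρ) =
      ∫ ρ in s..x, Set.IccExtend hst ((Set.Icc s t).domRestrict a) ρ := by
    intro x hx
    refine intervalIntegral.integral_congr fun y hy => ?_
    rw [Set.uIcc_of_le hx.1] at hy
    exact hab y ⟨hy.1, hy.2.trans hx.2⟩
  refine le_of_eq_of_le ?_ (iterated_aux s t hst _ c₀ hc₀ hb)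
  refine intervalIntegral.integral_congr fun x hx => ?_
  rw [Set.uIcc_of_le hst] at hx
  have hE : (∫ σ in s..x, Real.exp (c₀ * ∫ ρ in s..σ, a ρ)) = ∫ σ in s..x,
      Real.exp (c₀ * ∫ ρ in s..σ, Set.IccExtend hst ((Set.Icc s t).domRestrict a) ρ) := by
    refine intervalIntegral.integral_congr fun y hy => ?_
    rw [Set.uIcc_of_le hx.1] at hy
    have := hA y ⟨hy.1, hy.2.trans hx.2⟩
    simp only [this]
  simp only [hE, hA x hx, ← hab x hx]
end

section
/- Let α=2, δ≥0, and let (x,v) be a C¹ solution of the δ-Cucker–Smale system on [0,T₀) with |x_i(t)−x_j(t)|>δ for all i≠j. Then for every t∈[0,T₀): | d/dt (1/N²) Σ_{i≠j} log(|x_i(t)−x_j(t)|−δ) | ≤ 1/2 + (1/(2N²)) Σ_{i≠j} |v_i(t)−v_j(t)|² / (|x_i(t)−x_j(t)|−δ)². -/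
theorem log_norm_deriv_aux {d : ℕ} (w : ℝ → EuclideanSpace ℝ (Fin d)) (w' : EuclideanSpace ℝ (Fin d))
    (δ t : ℝ) (hδ : 0 ≤ δ) (hw : HasDerivAt w w' t) (hs : δ < ‖w t‖) :
    ∃ g : ℝ, HasDerivAt (fun s => Real.log (‖w s‖ - δ)) g t ∧
      |g| ≤ 1 / 2 + 1 / 2 * (‖w'‖ ^ 2 / (‖w t‖ - δ) ^ 2) := by
  have hpos : 0 < ‖w t‖ := lt_of_le_of_lt hδ hs
  have hp : 0 < ‖w t‖ - δ := sub_pos.mpr hs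
  have h1 := (hw.norm_sq).sqrt (by positivity)
  simp only [Real.sqrt_sq (norm_nonneg _)] at h1
  refine ⟨_, (h1.sub_const δ).log hp.ne', ?_⟩
  have hc : |inner ℝ (w t) w'| ≤ ‖w t‖ * ‖w'‖ := abs_real_inner_le_norm _ _
  have h2 : |2 * inner ℝ (w t) w' / (2 * ‖w t‖)| ≤ ‖w'‖ := by
    rw [mul_div_mul_left _ _ two_ne_zero, abs_div, abs_of_pos hpos, div_le_iff₀ hpos]
    linarith
  rw [abs_div, abs_of_pos hp]
  have h3 := div_le_div_of_nonneg_right h2 hp.le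
  refine h3.trans ?_
  rw [← div_pow]
  nlinarith [sq_nonneg (‖w'‖ / (‖w t‖ - δ) - 1)]

/-- Let `α = 2`, `δ ≥ 0`, and let `(x, v)` be a `C¹` solution of the
`δ`-Cucker–Smale system on `[0, T₀)` with `‖x_i(t) − x_j(t)‖ > δ` for all `i ≠ j`.  Then for
every `t ∈ [0, T₀)`:
`|d/dt (1/N²) Σ_{i≠j} log(‖x_i(t) − x_j(t)‖ − δ)|
  ≤ 1/2 + (1/(2N²)) Σ_{i≠j} ‖v_i(t) − v_j(t)‖² / (‖x_i(t) − x_j(t)‖ − δ)²`. -/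
theorem delta_cucker_smale_log_derivative_bound
    (d N : ℕ) (hN : 0 < N) (δ : ℝ) (hδ : 0 ≤ δ) (T₀ : ℝ) (hT₀ : 0 < T₀)
    (x v : ℝ → Fin N → EuclideanSpace ℝ (Fin d))
    (hx : ∀ i, ∀ t ∈ Set.Ico (0 : ℝ) T₀, HasDerivAt (fun s => x s i) (v t i) t)
    (hv : ∀ i, ∀ t ∈ Set.Ico (0 : ℝ) T₀, HasDerivAt (fun s => v s i)
      ((N : ℝ)⁻¹ • ∑ j ∈ Finset.univ.erase i,
        ((‖x t i - x t j‖ - δ) ^ (-(2 : ℝ))) • (v t j - v t i)) t)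
    (hsep : ∀ t ∈ Set.Ico (0 : ℝ) T₀, ∀ i j : Fin N, i ≠ j → δ < ‖x t i - x t j‖) :
    ∀ t ∈ Set.Ico (0 : ℝ) T₀, ∀ D : ℝ,
      HasDerivAt (fun s => ((N : ℝ) ^ 2)⁻¹ * ∑ i, ∑ j ∈ Finset.univ.erase i,
        Real.log (‖x s i - x s j‖ - δ)) D t →
      |D| ≤ 1 / 2 + (2 * (N : ℝ) ^ 2)⁻¹ * ∑ i, ∑ j ∈ Finset.univ.erase i,
        ‖v t i - v t j‖ ^ 2 / (‖x t i - x t j‖ - δ) ^ 2 := by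
  intro t ht D hD
  have key : ∀ i j : Fin N, ∃ g : ℝ, i ≠ j →
      (HasDerivAt (fun s => Real.log (‖x s i - x s j‖ - δ)) g t ∧
      |g| ≤ 1 / 2 + 1 / 2 * (‖v t i - v t j‖ ^ 2 / (‖x t i - x t j‖ - δ) ^ 2)) := by
    intro i j
    by_cases hij : i = j
    · exact ⟨0, fun h => absurd hij h⟩
    · obtain ⟨g, hg⟩ := log_norm_deriv_aux (fun s => x s i - x s j) _ δ t hδ
        ((hx i t ht).sub (hx j t ht)) (hsep t ht i j hij)
      exact ⟨g, fun _ => hg⟩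
  choose g hg using key
  have hD' : HasDerivAt (fun s => ((N : ℝ) ^ 2)⁻¹ * ∑ i, ∑ j ∈ Finset.univ.erase i,
        Real.log (‖x s i - x s j‖ - δ))
        (((N : ℝ) ^ 2)⁻¹ * ∑ i, ∑ j ∈ Finset.univ.erase i, g i j) t := by
    refine HasDerivAt.const_mul _ (HasDerivAt.fun_sum fun i _ => HasDerivAt.fun_sum fun j hj => ?_)
    exact (hg i j (Finset.ne_of_mem_erase hj).symm).1
  rw [hD.unique hD']
  have hNpos : (0 : ℝ) < N := by exact_mod_cast hN
  have hb : |∑ i, ∑ j ∈ Finset.univ.erase i, g i j| ≤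
      (N : ℝ) ^ 2 * (1 / 2) + 1 / 2 * ∑ i, ∑ j ∈ Finset.univ.erase i,
        ‖v t i - v t j‖ ^ 2 / (‖x t i - x t j‖ - δ) ^ 2 := by
    calc _ ≤ ∑ i, ∑ j ∈ Finset.univ.erase i, |g i j| :=
          (Finset.abs_sum_le_sum_abs _ _).trans
            (Finset.sum_le_sum fun i _ => Finset.abs_sum_le_sum_abs _ _)
      _ ≤ ∑ i : Fin N, ∑ j ∈ Finset.univ.erase i,
          (1 / 2 + 1 / 2 * (‖v t i - v t j‖ ^ 2 / (‖x t i - x t j‖ - δ) ^ 2)) :=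
          Finset.sum_le_sum fun i _ => Finset.sum_le_sum fun j hj =>
            (hg i j (Finset.ne_of_mem_erase hj).symm).2
      _ = ∑ i : Fin N, ∑ j ∈ Finset.univ.erase i, (1 / 2 : ℝ) +
          1 / 2 * ∑ i, ∑ j ∈ Finset.univ.erase i,
          ‖v t i - v t j‖ ^ 2 / (‖x t i - x t j‖ - δ) ^ 2 := by
          simp only [Finset.sum_add_distrib, Finset.mul_sum]
      _ ≤ _ := by
          gcongr
          calc _ ≤ ∑ i : Fin N, ∑ j : Fin N, (1 / 2 : ℝ) :=
                Finset.sum_le_sum fun i _ => Finset.sum_le_sum_of_subset_of_nonneg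
                  (Finset.erase_subset _ _) (fun _ _ _ => by norm_num)
            _ = _ := by
                simp only [Finset.sum_const, Finset.card_univ, Fintype.card_fin, nsmul_eq_mul]
                ring
  rw [abs_mul, abs_of_pos (by positivity)]
  refine (mul_le_mul_of_nonneg_left hb (by positivity)).trans (le_of_eq ?_)
  field_simp
end
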